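/- Abstract discrete energy balance for the incremental projection scheme: Let H be a real inner product space, Δt > 0, M ∈ ℕ, and let (u_m)_{0≤m≤M}, (ũ_m)_{1≤m≤M}, (q_m)_{0≤m≤M} be finite sequences in H and (D_m)_{1≤m≤M}, (W_m)_{1≤m≤M} real numbers such that for every 0 ≤ m ≤ M−1: (i) (1/2)(‖ũ_{m+1}‖² − ‖u_m‖² + ‖ũ_{m+1} − u_m‖²) + Δt D_{m+1} + Δt ⟨q_m, ũ_{m+1}⟩ = Δt W_{m+1}; (ii) u_{m+1} = ũ_{m+1} − Δt (q_{m+1} − q_m); (iii) ⟨u_{m+1}, q_{m+1}⟩ = 0. Then (1/2)‖u_M‖² + (Δt²/2)‖q_M‖² + (1/2) Σ_{m=0}^{M−1} ‖ũ_{m+1} − u_m‖² + Δt Σ_{m=0}^{M−1} D_{m+1} = (1/2)‖u_0‖² + (Δt²/2)‖q_0‖² + Δt Σ_{m=0}^{M−1} W_{m+1}. -/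

import Mathlib

open scoped RealInnerProductSpace

/-- Pythagorean identity for the incremental projection step: if
`v = w - t • (q' - q)` is orthogonal to `q'`, then `w + t • q = v + t • q'` has squared norm
`‖v‖² + t² ‖q'‖²`. -/
lemma norm_sq_add_inner_of_incremental_projection
    {H : Type*} [NormedAddCommGroup H] [InnerProductSpace ℝ H]
    {t : ℝ} {v w q q' : H} (hv : v = w - t • (q' - q)) (horth : ⟪v, q'⟫ = 0) :
    ‖w‖ ^ 2 + 2 * t * ⟪q, w⟫ + t ^ 2 * ‖q‖ ^ 2 = ‖v‖ ^ 2 + t ^ 2 * ‖q'‖ ^ 2 := by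
  have h : w + t • q = v + t • q' := by rw [hv]; module
  have h' := congrArg (fun x => ‖x‖ ^ 2) h
  simp only [norm_add_sq_real, real_inner_smul_right, norm_smul, mul_pow, Real.norm_eq_abs,
    sq_abs, horth, real_inner_comm q w] at h'
  linarith

/-- Abstract discrete energy balance for the incremental projection scheme
(Lemma 5.4 of the paper, abstracted): from the tested prediction-step identity (i),
the incremental projection step (ii), and the orthogonality relation (iii), the
discrete energy balance with modified energy `(1/2)‖u_m‖² + (Δt²/2)‖q_m‖²` follows. -/
theorem incremental_discrete_energy_balance
    {H : Type*} [NormedAddCommGroup H] [InnerProductSpace ℝ H]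
    (Δt : ℝ) (hΔt : 0 < Δt) (M : ℕ)
    (u ut q : ℕ → H) (D W : ℕ → ℝ)
    (h1 : ∀ m < M,
      (1 / 2) * (‖ut (m + 1)‖ ^ 2 - ‖u m‖ ^ 2 + ‖ut (m + 1) - u m‖ ^ 2)
        + Δt * D (m + 1) + Δt * ⟪q m, ut (m + 1)⟫ = Δt * W (m + 1))
    (h2 : ∀ m < M, u (m + 1) = ut (m + 1) - Δt • (q (m + 1) - q m))
    (h3 : ∀ m < M, ⟪u (m + 1), q (m + 1)⟫ = 0) :
    (1 / 2) * ‖u M‖ ^ 2 + (Δt ^ 2 / 2) * ‖q M‖ ^ 2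
      + (1 / 2) * ∑ m ∈ Finset.range M, ‖ut (m + 1) - u m‖ ^ 2
      + Δt * ∑ m ∈ Finset.range M, D (m + 1)
      = (1 / 2) * ‖u 0‖ ^ 2 + (Δt ^ 2 / 2) * ‖q 0‖ ^ 2
        + Δt * ∑ m ∈ Finset.range M, W (m + 1) := by
  induction M with
  | zero => simp
  | succ n ih =>
    have ih := ih (fun m hm => h1 m (hm.trans n.lt_succ_self))
      (fun m hm => h2 m (hm.trans n.lt_succ_self)) (fun m hm => h3 m (hm.trans n.lt_succ_self))
    have hproj := norm_sq_add_inner_of_incremental_projection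
      (h2 n n.lt_succ_self) (h3 n n.lt_succ_self)
    have hpred := h1 n n.lt_succ_self
    simp only [Finset.sum_range_succ]
    linarith
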